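/- arXiv:1101.3582 — 9 statements merged into one kernel-verified Lean document; each statement's English description precedes it below -/
import Mathlib

section
/- Let β = (1+i)/√2 and define f : [0, 2π] → ℂ by f(x) = (π/(β·sinh(βπ)))·cosh(β(x − π)). Then for every integer n, (1/(2π)) ∫₀^{2π} f(x) e^{−inx} dx = 1/(n² + i). -/
open Complex

/-- `sinh (β π)` does not vanish unless `β` is an integer multiple of `I`. -/
lemma sinh_mul_pi_ne_zero {β : ℂ} (hβ : ∀ k : ℤ, β ^ 2 + (k : ℂ) ^ 2 ≠ 0) :
    Complex.sinh (β * (Real.pi : ℂ)) ≠ 0 := by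
  intro h
  have hsin : Complex.sin (β * (Real.pi : ℂ) * Complex.I) = 0 := by
    rw [Complex.sin_mul_I, h, zero_mul]
  obtain ⟨k, hk⟩ := Complex.sin_eq_zero_iff.mp hsin
  have hpi : (Real.pi : ℂ) ≠ 0 := Complex.ofReal_ne_zero.mpr Real.pi_ne_zero
  have hk' : β * Complex.I = k := mul_right_cancel₀ hpi (by linear_combination hk)
  apply hβ k
  rw [← hk', mul_pow, Complex.I_sq]
  ring

/-- The integral of `cosh (β (x - π))` against the `n`-th Fourier character over one period. -/
lemma integral_cosh_mul_exp (β : ℂ) (n : ℤ) (hn : β ^ 2 + (n : ℂ) ^ 2 ≠ 0) :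
    ∫ x in (0:ℝ)..(2 * Real.pi), Complex.cosh (β * ((x : ℂ) - (Real.pi : ℂ))) *
        Complex.exp (-Complex.I * (n : ℂ) * (x : ℂ)) =
      2 * β * Complex.sinh (β * (Real.pi : ℂ)) / (β ^ 2 + (n : ℂ) ^ 2) := by
  have hderiv : ∀ z : ℂ, HasDerivAt
      (fun z : ℂ => Complex.exp (-Complex.I * (n : ℂ) * z) *
        (β * Complex.sinh (β * (z - (Real.pi : ℂ))) +
          Complex.I * n * Complex.cosh (β * (z - (Real.pi : ℂ)))) / (β ^ 2 + (n : ℂ) ^ 2))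
      (Complex.cosh (β * (z - (Real.pi : ℂ))) * Complex.exp (-Complex.I * (n : ℂ) * z)) z := by
    intro z
    have hlin : HasDerivAt (fun z : ℂ => β * (z - (Real.pi : ℂ))) (β * 1) z :=
      ((hasDerivAt_id z).sub_const _).const_mul β
    have hexp := ((hasDerivAt_id z).const_mul (-Complex.I * (n : ℂ))).cexp
    refine ((hexp.mul ((hlin.csinh.const_mul β).add
      (hlin.ccosh.const_mul (Complex.I * n)))).div_const (β ^ 2 + (n : ℂ) ^ 2)).congr_deriv ?_
    rw [div_eq_iff hn]
    simp only [Pi.add_apply, id_eq]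
    ring_nf
    simp only [Complex.I_sq]
    ring
  have hperiod : Complex.exp (-Complex.I * (n : ℂ) * ((2 * Real.pi : ℝ) : ℂ)) = 1 := by
    rw [Complex.exp_eq_one_iff]
    exact ⟨-n, by push_cast; ring⟩
  rw [intervalIntegral.integral_eq_sub_of_hasDerivAt (fun x _ => (hderiv x).comp_ofReal)
    (Continuous.intervalIntegrable (by fun_prop) _ _), hperiod]
  have hright : β * (((2 * Real.pi : ℝ) : ℂ) - (Real.pi : ℂ)) = β * (Real.pi : ℂ) := by
    push_cast; ring
  have hleft : β * (((0 : ℝ) : ℂ) - (Real.pi : ℂ)) = -(β * (Real.pi : ℂ)) := by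
    push_cast; ring
  rw [hright, hleft, Complex.sinh_neg, Complex.cosh_neg, Complex.ofReal_zero, mul_zero,
    Complex.exp_zero]
  ring

/-- Fourier coefficients of the periodic Green kernel of `-d²/dx² + i`:
for `β = (1+i)/√2` and `f x = (π/(β sinh(βπ))) cosh(β(x-π))`, the `n`-th Fourier
coefficient of `f` equals `1/(n² + i)`. -/
theorem fourier_coeff_green_kernel (β : ℂ) (hβ : β = (1 + Complex.I) / (Real.sqrt 2 : ℂ))
    (f : ℝ → ℂ)
    (hf : ∀ x : ℝ, f x =
      ((Real.pi : ℂ) / (β * Complex.sinh (β * (Real.pi : ℂ)))) *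
        Complex.cosh (β * ((x : ℂ) - (Real.pi : ℂ))))
    (n : ℤ) :
    (1 / (2 * (Real.pi : ℂ))) * ∫ x in (0:ℝ)..(2 * Real.pi),
        f x * Complex.exp (-Complex.I * (n : ℂ) * (x : ℂ)) =
      1 / ((n : ℂ) ^ 2 + Complex.I) := by
  have hsq : β ^ 2 = Complex.I := by
    have hsqrt : (Real.sqrt 2 : ℂ) ^ 2 = 2 := by
      rw [← Complex.ofReal_pow, Real.sq_sqrt zero_le_two, Complex.ofReal_ofNat]
    rw [hβ, div_pow, hsqrt]
    linear_combination Complex.I_sq / 2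
  have hne : ∀ k : ℤ, β ^ 2 + (k : ℂ) ^ 2 ≠ 0 := by
    intro k hk
    rw [hsq, ← Int.cast_pow] at hk
    have him := congrArg Complex.im hk
    rw [Complex.add_im, Complex.I_im, Complex.intCast_im, Complex.zero_im, add_zero] at him
    exact one_ne_zero him
  have hβ0 : β ≠ 0 := fun h => hne 0 (by simp [h])
  have hsinh := sinh_mul_pi_ne_zero hne
  have hpi : (Real.pi : ℂ) ≠ 0 := Complex.ofReal_ne_zero.mpr Real.pi_ne_zero
  simp only [hf, mul_assoc (_ / _)]
  rw [intervalIntegral.integral_const_mul, integral_cosh_mul_exp β n (hne n), ← hsq,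
    add_comm ((n : ℂ) ^ 2)]
  have hn := hne n
  field_simp
  rw [mul_comm, div_self hsinh]
end

section
/- Let γ < 0. For every integer j ≥ 1 there exists a unique κ ∈ (j − 1/2, j) such that cos(κπ)/sin(κπ) = 2κ/γ. -/
theorem sin_mul_pi_ne_zero_of_mem_Ioo {j : ℕ} {κ : ℝ}
    (h : κ ∈ Set.Ioo ((j : ℝ) - 1/2) (j : ℝ)) : Real.sin (κ * Real.pi) ≠ 0 := by
  intro h0
  obtain ⟨n, hn⟩ := Real.sin_eq_zero_iff.1 h0
  have hκ : (n : ℝ) = κ := mul_right_cancel₀ Real.pi_ne_zero hn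
  obtain ⟨h1, h2⟩ := h
  rw [← hκ] at h1 h2
  have h3 : n < (j : ℤ) := by exact_mod_cast h2
  have h4 : (n : ℝ) + 1 ≤ j := by exact_mod_cast h3
  linarith

/-- The inequality `cot(bπ)/b < cot(aπ)/a` for `a < b`, cleared of denominators. -/
theorem mul_cos_mul_sin_lt {a b : ℝ} (hab : a < b) (hba : b - a ≤ 1/2) (hsum : 1 < a + b) :
    a * (Real.cos (b * Real.pi) * Real.sin (a * Real.pi)) <
      b * (Real.cos (a * Real.pi) * Real.sin (b * Real.pi)) := by
  have hπ := Real.pi_pos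
  have hsin : 2 / Real.pi * ((b - a) * Real.pi) ≤ Real.sin ((b - a) * Real.pi) :=
    Real.mul_le_sin (by nlinarith) (by nlinarith)
  have hsin' : 2 * (b - a) ≤ Real.sin ((b - a) * Real.pi) := by
    convert hsin using 1
    field_simp
  have hsub := Real.sin_sub (b * Real.pi) (a * Real.pi)
  have hadd := Real.sin_add (b * Real.pi) (a * Real.pi)
  rw [← sub_mul] at hsub
  have hge := Real.neg_one_le_sin (b * Real.pi + a * Real.pi)
  nlinarith [mul_le_mul_of_nonneg_left hsin' (by linarith : 0 ≤ a + b),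
    mul_le_mul_of_nonneg_left hge (sub_pos.2 hab).le, mul_pos (sub_pos.2 hab) (sub_pos.2 hsum)]

theorem cos_div_sin_eq_iff {γ : ℝ} (hγ : γ ≠ 0) {κ : ℝ} (hs : Real.sin (κ * Real.pi) ≠ 0) :
    Real.cos (κ * Real.pi) / Real.sin (κ * Real.pi) = 2 * κ / γ ↔
      γ * Real.cos (κ * Real.pi) - 2 * κ * Real.sin (κ * Real.pi) = 0 := by
  rw [div_eq_div_iff hs hγ, sub_eq_zero, mul_comm γ]

theorem exists_mem_Ioo_mul_cos_sub_eq_zero {γ : ℝ} (hγ : γ < 0) {j : ℕ} (hj : 1 ≤ j) :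
    ∃ κ ∈ Set.Ioo ((j : ℝ) - 1/2) (j : ℝ),
      γ * Real.cos (κ * Real.pi) - 2 * κ * Real.sin (κ * Real.pi) = 0 := by
  have hj' : (1 : ℝ) ≤ j := by exact_mod_cast hj
  let f : ℝ → ℝ := fun κ ↦ Real.cos (j * Real.pi) *
    (γ * Real.cos (κ * Real.pi) - 2 * κ * Real.sin (κ * Real.pi))
  have hf : Continuous f := by fun_prop
  have hsj : Real.sin (j * Real.pi) = 0 := Real.sin_nat_mul_pi j
  have hcj : Real.cos (j * Real.pi) ^ 2 = 1 := by
    nlinarith [Real.sin_sq_add_cos_sq (j * Real.pi)]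
  have hangle : ((j : ℝ) - 1/2) * Real.pi = j * Real.pi - Real.pi / 2 := by ring
  have hleft : f (j - 1/2) = 2 * j - 1 := by
    simp only [f, hangle, Real.cos_sub_pi_div_two, Real.sin_sub_pi_div_two, hsj]
    linear_combination (2 * (j : ℝ) - 1) * hcj
  have hright : f j = γ := by
    simp only [f, hsj]
    linear_combination γ * hcj
  obtain ⟨κ, hκ, hκ0⟩ := intermediate_value_Ioo' (by linarith : (j : ℝ) - 1/2 ≤ j)
    hf.continuousOn (show (0 : ℝ) ∈ Set.Ioo (f j) (f (j - 1/2)) by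
      rw [hleft, hright]; exact ⟨hγ, by linarith⟩)
  have hc : Real.cos (j * Real.pi) ≠ 0 := fun h ↦ by simp [h] at hcj
  exact ⟨κ, hκ, (mul_eq_zero.1 hκ0).resolve_left hc⟩

/-- For `γ < 0` and every integer `j ≥ 1` there is a unique `κ ∈ (j - 1/2, j)` with
`cot(κπ) = 2κ/γ`. -/
theorem exists_unique_eigenvalue_neg_strength (γ : ℝ) (hγ : γ < 0) (j : ℕ) (hj : 1 ≤ j) :
    ∃! κ : ℝ, κ ∈ Set.Ioo ((j : ℝ) - 1/2) (j : ℝ) ∧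
      Real.cos (κ * Real.pi) / Real.sin (κ * Real.pi) = 2 * κ / γ := by
  have hj' : (1 : ℝ) ≤ j := by exact_mod_cast hj
  refine existsUnique_of_exists_of_unique ?_ ?_
  · obtain ⟨κ, hκ, h0⟩ := exists_mem_Ioo_mul_cos_sub_eq_zero hγ hj
    exact ⟨κ, hκ, (cos_div_sin_eq_iff hγ.ne (sin_mul_pi_ne_zero_of_mem_Ioo hκ)).2 h0⟩
  · rintro x y ⟨hx, ex⟩ ⟨hy, ey⟩
    rw [cos_div_sin_eq_iff hγ.ne (sin_mul_pi_ne_zero_of_mem_Ioo hx)] at ex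
    rw [cos_div_sin_eq_iff hγ.ne (sin_mul_pi_ne_zero_of_mem_Ioo hy)] at ey
    have key : y * (Real.cos (x * Real.pi) * Real.sin (y * Real.pi)) =
        x * (Real.cos (y * Real.pi) * Real.sin (x * Real.pi)) := by
      apply mul_left_cancel₀ hγ.ne
      linear_combination y * Real.sin (y * Real.pi) * ex - x * Real.sin (x * Real.pi) * ey
    obtain ⟨hx1, hx2⟩ := hx
    obtain ⟨hy1, hy2⟩ := hy
    rcases lt_trichotomy x y with h | h | h
    · exact absurd key (mul_cos_mul_sin_lt h (by linarith) (by linarith)).ne'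
    · exact h
    · exact absurd key (mul_cos_mul_sin_lt h (by linarith) (by linarith)).ne
end

section
/- Let γ > 0 and λ < 0. If ζ : ℝ → ℝ satisfies the periodic δ-conditions with strength γ and period 2π, and −ζ''(x) = λ·ζ(x) for all x ∈ ℝ ∖ 2πℤ, then ζ is identically zero. -/
open Filter Set

/-- `ζ : ℝ → ℝ` satisfies the periodic δ-conditions with strength `γ` and period `ℓ`:
it is `ℓ`-periodic, continuous, twice continuously differentiable off the lattice `ℓℤ`,
its one-sided derivatives at `0` exist, and they jump by `γ ζ(0)`. -/
def PeriodicDeltaConditions (γ ℓ : ℝ) (ζ : ℝ → ℝ) : Prop :=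
  Function.Periodic ζ ℓ ∧ Continuous ζ ∧
  ContDiffOn ℝ 2 ζ {x : ℝ | ∀ n : ℤ, x ≠ n * ℓ} ∧
  ∃ a b : ℝ, Tendsto (deriv ζ) (nhdsWithin 0 (Set.Ioi 0)) (nhds a) ∧
    Tendsto (deriv ζ) (nhdsWithin 0 (Set.Iio 0)) (nhds b) ∧
    a - b = γ * ζ 0

/-- The period-`ℓ` δ-conditions are invariant under negation. -/
theorem PeriodicDeltaConditions.neg {γ ℓ : ℝ} {ζ : ℝ → ℝ}
    (hζ : PeriodicDeltaConditions γ ℓ ζ) :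
    PeriodicDeltaConditions γ ℓ (fun x => -ζ x) := by
  obtain ⟨hper, hcont, hdiff, a, b, ha, hb, hab⟩ := hζ
  have hderiv : deriv (fun x => -ζ x) = fun x => -deriv ζ x := by
    ext x
    simp
  refine ⟨fun x => congrArg Neg.neg (hper x), hcont.neg, hdiff.neg, -a, -b, ?_, ?_, by linarith⟩
  · rw [hderiv]
    exact ha.neg
  · rw [hderiv]
    exact hb.neg

/-- A continuous periodic real function attains a global maximum. -/
theorem Function.Periodic.exists_forall_le_of_continuous {f : ℝ → ℝ} {ℓ : ℝ}
    (hper : Function.Periodic f ℓ) (hℓ : 0 < ℓ) (hf : Continuous f) :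
    ∃ x, ∀ y, f y ≤ f x := by
  obtain ⟨x, -, hx⟩ := isCompact_Icc.exists_isMaxOn (nonempty_Icc.2 hℓ.le) hf.continuousOn
  refine ⟨x, fun y => ?_⟩
  obtain ⟨z, hz, hyz⟩ := hper.exists_mem_Ico₀ hℓ y
  rw [hyz]
  exact hx (Ico_subset_Icc_self hz)

/-- At a local maximum of a continuous function the second derivative is not positive. -/
theorem IsLocalMax.deriv_deriv_nonpos {f : ℝ → ℝ} {x : ℝ} (h : IsLocalMax f x)
    (hf : ContinuousAt f x) : deriv (deriv f) x ≤ 0 := by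
  by_contra! hpos
  have hmin : IsLocalMin f x := isLocalMin_of_deriv_deriv_pos hpos h.deriv_eq_zero hf
  have hconst : f =ᶠ[nhds x] fun _ => f x := by
    filter_upwards [h, hmin] with y h₁ h₂ using le_antisymm h₁ h₂
  have hzero : deriv (deriv f) x = 0 := by
    rw [hconst.deriv.deriv_eq]
    simp
  exact hpos.ne' hzero

/-- If `x` is a global maximum, the right limit of the derivative at `x` is not positive. -/
theorem nonpos_of_tendsto_deriv_nhdsGT {f : ℝ → ℝ} {x a : ℝ} {s : Set ℝ}
    (hmax : ∀ y, f y ≤ f x) (hf : ContinuousAt f x) (hs : s ∈ nhdsWithin x (Ioi x))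
    (hdiff : DifferentiableOn ℝ f s)
    (ha : Tendsto (deriv f) (nhdsWithin x (Ioi x)) (nhds a)) : a ≤ 0 := by
  obtain ⟨c, hc, hcs⟩ := mem_nhdsGT_iff_exists_Ioo_subset.1 hs
  have hderiv : HasDerivWithinAt f a (Ici x) x :=
    hasDerivWithinAt_Ici_of_tendsto_deriv (hdiff.mono hcs) hf.continuousWithinAt
      (Ioo_mem_nhdsGT hc) ha
  have hslope := hasDerivWithinAt_iff_tendsto_slope' (s := Ioi x) (by simp) |>.1 hderiv.Ioi_of_Ici
  refine le_of_tendsto hslope (eventually_nhdsWithin_of_forall fun y hy => ?_)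
  rw [slope_def_field]
  exact div_nonpos_of_nonpos_of_nonneg (sub_nonpos.2 (hmax y)) (sub_nonneg.2 (le_of_lt hy))

/-- If `x` is a global maximum, the left limit of the derivative at `x` is not negative. -/
theorem nonneg_of_tendsto_deriv_nhdsLT {f : ℝ → ℝ} {x b : ℝ} {s : Set ℝ}
    (hmax : ∀ y, f y ≤ f x) (hf : ContinuousAt f x) (hs : s ∈ nhdsWithin x (Iio x))
    (hdiff : DifferentiableOn ℝ f s)
    (hb : Tendsto (deriv f) (nhdsWithin x (Iio x)) (nhds b)) : 0 ≤ b := by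
  obtain ⟨c, hc, hcs⟩ := mem_nhdsLT_iff_exists_Ioo_subset.1 hs
  have hderiv : HasDerivWithinAt f b (Iic x) x :=
    hasDerivWithinAt_Iic_of_tendsto_deriv (hdiff.mono hcs) hf.continuousWithinAt
      (Ioo_mem_nhdsLT hc) hb
  have hslope := hasDerivWithinAt_iff_tendsto_slope' (s := Iio x) (by simp) |>.1 hderiv.Iio_of_Iic
  refine ge_of_tendsto hslope (eventually_nhdsWithin_of_forall fun y hy => ?_)
  rw [slope_def_field]
  exact div_nonneg_of_nonpos (sub_nonpos.2 (hmax y)) (sub_nonpos.2 (le_of_lt hy))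

/-- Maximum principle: for positive strength and negative `lam`, a solution of `-ζ'' = lam ζ`
satisfying the periodic δ-conditions is nowhere positive. -/
theorem PeriodicDeltaConditions.nonpos {γ ℓ lam : ℝ} (hγ : 0 < γ) (hℓ : 0 < ℓ) (hlam : lam < 0)
    {ζ : ℝ → ℝ} (hζ : PeriodicDeltaConditions γ ℓ ζ)
    (heq : ∀ x : ℝ, (∀ n : ℤ, x ≠ n * ℓ) → -(deriv (deriv ζ) x) = lam * ζ x) (x : ℝ) :
    ζ x ≤ 0 := by
  obtain ⟨hper, hcont, hdiff, a, b, ha, hb, hab⟩ := hζ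
  obtain ⟨m, hm⟩ := hper.exists_forall_le_of_continuous hℓ hcont
  refine (hm x).trans ?_
  by_contra! hpos
  by_cases hlat : ∀ n : ℤ, m ≠ n * ℓ
  · have hnonpos : deriv (deriv ζ) m ≤ 0 :=
      IsLocalMax.deriv_deriv_nonpos (Eventually.of_forall hm) hcont.continuousAt
    nlinarith [heq m hlat, mul_neg_of_neg_of_pos hlam hpos]
  · push Not at hlat
    obtain ⟨n, rfl⟩ := hlat
    have hzero : ζ (n * ℓ) = ζ 0 := hper.int_mul_eq n
    rw [hzero] at hm hpos
    have hd := hdiff.differentiableOn (by norm_num)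
    have hright : Ioo 0 ℓ ⊆ {x : ℝ | ∀ n : ℤ, x ≠ n * ℓ} := by
      rintro _ ⟨h₁, h₂⟩ k rfl
      have hk₁ : (0 : ℝ) < k := pos_of_mul_pos_left h₁ hℓ.le
      have hk₂ : (k : ℝ) < 1 := by nlinarith
      norm_cast at hk₁ hk₂
      lia
    have hleft : Ioo (-ℓ) 0 ⊆ {x : ℝ | ∀ n : ℤ, x ≠ n * ℓ} := by
      intro y hy k hk
      refine hright (a := -y) ⟨by linarith [hy.2], by linarith [hy.1]⟩ (-k) ?_
      rw [hk]
      push_cast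
      ring
    have ha' := nonpos_of_tendsto_deriv_nhdsGT hm hcont.continuousAt
      (Ioo_mem_nhdsGT hℓ) (hd.mono hright) ha
    have hb' := nonneg_of_tendsto_deriv_nhdsLT hm hcont.continuousAt
      (Ioo_mem_nhdsLT (neg_lt_zero.2 hℓ)) (hd.mono hleft) hb
    linarith [mul_pos hγ hpos]

/-- For `γ > 0`, the periodic δ-interaction operator `-Δ_γ` has no negative eigenvalue:
if `-ζ'' = λ ζ` off the lattice `2πℤ` with `λ < 0`, then `ζ ≡ 0`. -/
theorem no_negative_eigenvalue_pos_strength (γ lam : ℝ) (hγ : 0 < γ) (hlam : lam < 0)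
    (ζ : ℝ → ℝ) (hζ : PeriodicDeltaConditions γ (2 * Real.pi) ζ)
    (heq : ∀ x : ℝ, (∀ n : ℤ, x ≠ n * (2 * Real.pi)) →
      -(deriv (deriv ζ) x) = lam * ζ x) :
    ∀ x : ℝ, ζ x = 0 := by
  intro x
  refine le_antisymm (hζ.nonpos hγ Real.two_pi_pos hlam heq x) ?_
  refine neg_nonpos.1 (hζ.neg.nonpos hγ Real.two_pi_pos hlam (fun y hy => ?_) x)
  have hderiv : deriv (fun x => -ζ x) = fun x => -deriv ζ x := by
    ext z
    simp
  rw [hderiv, deriv.fun_neg]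
  linarith [heq y hy]
end

section
/- Let μ > 0 and set γ = −2μ·tanh(μπ). Define ψ : ℝ → ℝ as the 2π-periodic extension of ξ ↦ cosh(μ(|ξ| − π)) from [−π, π]. Then ψ(x) > 0 for all x, ψ satisfies the periodic δ-conditions with strength γ and period 2π, and ψ''(x) = μ²·ψ(x) for all x ∈ ℝ ∖ 2πℤ. -/
open Filter Set

section CoshExtension

variable {μ : ℝ} {ψ : ℝ → ℝ}

/-- On each period cell the periodic extension is a single translated hyperbolic cosine. -/
lemma eq_cosh_of_mem_cell (hper : Function.Periodic ψ (2 * Real.pi))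
    (hval : ∀ x ∈ Set.Icc (-Real.pi) Real.pi, ψ x = Real.cosh (μ * (|x| - Real.pi)))
    (n : ℤ) {x : ℝ} (hx : x ∈ Set.Icc (n * (2 * Real.pi)) (n * (2 * Real.pi) + 2 * Real.pi)) :
    ψ x = Real.cosh (μ * (x - n * (2 * Real.pi) - Real.pi)) := by
  obtain ⟨h₁, h₂⟩ := hx
  rcases le_total (x - n * (2 * Real.pi)) Real.pi with h | h
  · rw [← hper.sub_int_mul_eq n, hval _ ⟨by linarith [Real.pi_pos], h⟩,
      abs_of_nonneg (by linarith)]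
  · rw [← hper.sub_int_mul_eq n, ← hper.sub_eq, hval _ ⟨by linarith, by linarith [Real.pi_pos]⟩,
      abs_of_nonpos (by linarith), ← Real.cosh_neg]
    congr 1
    ring

lemma exists_mem_cell (x : ℝ) :
    ∃ n : ℤ, x ∈ Set.Ico (n * (2 * Real.pi)) (n * (2 * Real.pi) + 2 * Real.pi) := by
  have hT := Real.two_pi_pos
  refine ⟨⌊x / (2 * Real.pi)⌋, (le_div_iff₀ hT).1 (Int.floor_le _), ?_⟩
  have h := (div_lt_iff₀ hT).1 (Int.lt_floor_add_one (x / (2 * Real.pi)))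
  linarith

lemma exists_mem_open_cell {x : ℝ} (hx : ∀ n : ℤ, x ≠ n * (2 * Real.pi)) :
    ∃ n : ℤ, x ∈ Set.Ioo (n * (2 * Real.pi)) (n * (2 * Real.pi) + 2 * Real.pi) := by
  obtain ⟨n, h₁, h₂⟩ := exists_mem_cell x
  exact ⟨n, lt_of_le_of_ne h₁ (hx n).symm, h₂⟩

lemma eventuallyEq_cosh_of_mem_open_cell (hper : Function.Periodic ψ (2 * Real.pi))
    (hval : ∀ x ∈ Set.Icc (-Real.pi) Real.pi, ψ x = Real.cosh (μ * (|x| - Real.pi)))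
    {n : ℤ} {x : ℝ} (hx : x ∈ Set.Ioo (n * (2 * Real.pi)) (n * (2 * Real.pi) + 2 * Real.pi)) :
    ψ =ᶠ[nhds x] fun y => Real.cosh (μ * (y - n * (2 * Real.pi) - Real.pi)) := by
  filter_upwards [Ioo_mem_nhds hx.1 hx.2] with y hy
  exact eq_cosh_of_mem_cell hper hval n (Ioo_subset_Icc_self hy)

lemma hasDerivAt_cosh_mul_sub (μ c d x : ℝ) :
    HasDerivAt (fun y => Real.cosh (μ * (y - c - d))) (μ * Real.sinh (μ * (x - c - d))) x := by
  have h := ((((hasDerivAt_id x).sub_const c).sub_const d).const_mul μ).cosh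
  simpa [mul_comm] using h

lemma hasDerivAt_sinh_mul_sub (μ c d x : ℝ) :
    HasDerivAt (fun y => Real.sinh (μ * (y - c - d))) (μ * Real.cosh (μ * (x - c - d))) x := by
  have h := ((((hasDerivAt_id x).sub_const c).sub_const d).const_mul μ).sinh
  simpa [mul_comm] using h

lemma deriv_eq_sinh_of_mem_open_cell (hper : Function.Periodic ψ (2 * Real.pi))
    (hval : ∀ x ∈ Set.Icc (-Real.pi) Real.pi, ψ x = Real.cosh (μ * (|x| - Real.pi)))
    {n : ℤ} {x : ℝ} (hx : x ∈ Set.Ioo (n * (2 * Real.pi)) (n * (2 * Real.pi) + 2 * Real.pi)) :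
    deriv ψ x = μ * Real.sinh (μ * (x - n * (2 * Real.pi) - Real.pi)) :=
  (eventuallyEq_cosh_of_mem_open_cell hper hval hx).deriv_eq.trans
    (hasDerivAt_cosh_mul_sub μ _ _ x).deriv

lemma continuous_of_cosh_extension (hper : Function.Periodic ψ (2 * Real.pi))
    (hval : ∀ x ∈ Set.Icc (-Real.pi) Real.pi, ψ x = Real.cosh (μ * (|x| - Real.pi))) :
    Continuous ψ := by
  have hπ := Real.pi_pos
  refine continuous_iff_continuousAt.2 fun x => ?_
  by_cases hx : ∀ n : ℤ, x ≠ n * (2 * Real.pi)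
  · obtain ⟨n, hn⟩ := exists_mem_open_cell hx
    exact (hasDerivAt_cosh_mul_sub μ _ _ x).continuousAt.congr
      (eventuallyEq_cosh_of_mem_open_cell hper hval hn).symm
  · push Not at hx
    obtain ⟨n, rfl⟩ := hx
    have hc : Continuous fun y : ℝ => Real.cosh (μ * (|y - n * (2 * Real.pi)| - Real.pi)) := by
      fun_prop
    refine hc.continuousAt.congr ?_
    filter_upwards [Ioo_mem_nhds (sub_lt_self (n * (2 * Real.pi)) hπ)
      (lt_add_of_pos_right (n * (2 * Real.pi)) hπ)] with y hy
    rw [← hper.sub_int_mul_eq n, hval _ ⟨by linarith [hy.1], by linarith [hy.2]⟩]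

lemma tendsto_deriv_of_cell (hper : Function.Periodic ψ (2 * Real.pi))
    (hval : ∀ x ∈ Set.Icc (-Real.pi) Real.pi, ψ x = Real.cosh (μ * (|x| - Real.pi)))
    (n : ℤ) (a : ℝ) {s : Set ℝ}
    (hs : Set.Ioo (n * (2 * Real.pi)) (n * (2 * Real.pi) + 2 * Real.pi) ∈ nhdsWithin a s) :
    Tendsto (deriv ψ) (nhdsWithin a s)
      (nhds (μ * Real.sinh (μ * (a - n * (2 * Real.pi) - Real.pi)))) := by
  have hc : Continuous fun y : ℝ => μ * Real.sinh (μ * (y - n * (2 * Real.pi) - Real.pi)) := by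
    fun_prop
  refine ((hc.tendsto a).mono_left nhdsWithin_le_nhds).congr' ?_
  filter_upwards [hs] with y hy
  exact (deriv_eq_sinh_of_mem_open_cell hper hval hy).symm

end CoshExtension

/-- For `μ > 0` and `γ = -2μ tanh(μπ)`, the `2π`-periodic extension `ψ` of
`ξ ↦ cosh(μ(|ξ| - π))` from `[-π, π]` is strictly positive, satisfies the periodic
δ-conditions with strength `γ`, and solves `ψ'' = μ² ψ` off the lattice `2πℤ`. -/
theorem negative_eigenfunction_properties (μ γ : ℝ) (hμ : 0 < μ)
    (hγ : γ = -(2 * μ * Real.tanh (μ * Real.pi)))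
    (ψ : ℝ → ℝ) (hper : Function.Periodic ψ (2 * Real.pi))
    (hval : ∀ x ∈ Set.Icc (-Real.pi) Real.pi, ψ x = Real.cosh (μ * (|x| - Real.pi))) :
    (∀ x : ℝ, 0 < ψ x) ∧
    PeriodicDeltaConditions γ (2 * Real.pi) ψ ∧
    (∀ x : ℝ, (∀ n : ℤ, x ≠ n * (2 * Real.pi)) →
      deriv (deriv ψ) x = μ ^ 2 * ψ x) := by
  have hπ := Real.pi_pos
  refine ⟨fun x => ?_, ⟨hper, continuous_of_cosh_extension hper hval, fun x hx => ?_,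
    μ * Real.sinh (μ * (0 - (0 : ℤ) * (2 * Real.pi) - Real.pi)),
    μ * Real.sinh (μ * (0 - (-1 : ℤ) * (2 * Real.pi) - Real.pi)),
    tendsto_deriv_of_cell hper hval 0 0 ?_, tendsto_deriv_of_cell hper hval (-1) 0 ?_, ?_⟩,
    fun x hx => ?_⟩
  · obtain ⟨n, hn⟩ := exists_mem_cell x
    rw [eq_cosh_of_mem_cell hper hval n (Ico_subset_Icc_self hn)]
    exact Real.cosh_pos _
  · obtain ⟨n, hn⟩ := exists_mem_open_cell hx
    have hc : ContDiff ℝ 2 fun y : ℝ => Real.cosh (μ * (y - n * (2 * Real.pi) - Real.pi)) :=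
      Real.contDiff_cosh.comp (by fun_prop)
    exact (hc.contDiffAt.congr_of_eventuallyEq
      (eventuallyEq_cosh_of_mem_open_cell hper hval hn)).contDiffWithinAt
  · exact mem_of_superset (Ioo_mem_nhdsGT Real.two_pi_pos) (by simp)
  · exact mem_of_superset (Ioo_mem_nhdsLT (neg_lt_zero.2 Real.two_pi_pos)) (by simp)
  · have h₁ : μ * (0 - ((0 : ℤ) : ℝ) * (2 * Real.pi) - Real.pi) = -(μ * Real.pi) := by
      push_cast; ring
    have h₂ : μ * (0 - ((-1 : ℤ) : ℝ) * (2 * Real.pi) - Real.pi) = μ * Real.pi := by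
      push_cast; ring
    have h₃ : μ * (|0| - Real.pi) = -(μ * Real.pi) := by simp
    rw [h₁, h₂, hγ, hval 0 ⟨by linarith, hπ.le⟩, h₃, Real.sinh_neg, Real.cosh_neg,
      Real.tanh_eq_sinh_div_cosh]
    field_simp [(Real.cosh_pos (μ * Real.pi)).ne']
    ring
  · obtain ⟨n, hn⟩ := exists_mem_open_cell hx
    have hd : deriv ψ =ᶠ[nhds x]
        fun y => μ * Real.sinh (μ * (y - n * (2 * Real.pi) - Real.pi)) := by
      filter_upwards [Ioo_mem_nhds hn.1 hn.2] with y hy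
      exact deriv_eq_sinh_of_mem_open_cell hper hval hy
    rw [hd.deriv_eq, ((hasDerivAt_sinh_mul_sub μ _ _ x).const_mul μ).deriv,
      eq_cosh_of_mem_cell hper hval n (Ioo_subset_Icc_self hn)]
    ring
end

section
/- Let Z ≠ 0, let η₁ > η₂ > 0, and set F(t) = (η₁² − t²)(t² − η₂²). Suppose c ≥ 0 and a, b ∈ ℝ satisfy a² = F(c)/2, b² = F(c)/2, and a − b = −Z·c. Then c > 0, a = −b = −Z·c/2, Z²·c²/4 = F(c)/2, and η₂ < c < η₁. -/
/-- Matching condition at the defect: if `a² = b² = F(c)/2` with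
`F(t) = (η₁² - t²)(t² - η₂²)` and `a - b = -Z c` with `Z ≠ 0`, `c ≥ 0`, then
`c > 0`, `a = -Zc/2 = -b`, `Z²c²/4 = F(c)/2` and `η₂ < c < η₁`. -/
theorem defect_matching_condition (Z η₁ η₂ : ℝ) (hZ : Z ≠ 0)
    (h21 : η₂ < η₁) (h2 : 0 < η₂)
    (F : ℝ → ℝ) (hF : ∀ t : ℝ, F t = (η₁ ^ 2 - t ^ 2) * (t ^ 2 - η₂ ^ 2))
    (c a b : ℝ) (hc : 0 ≤ c)
    (ha : a ^ 2 = F c / 2) (hb : b ^ 2 = F c / 2) (hab : a - b = -Z * c) :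
    0 < c ∧ a = -(Z * c) / 2 ∧ b = Z * c / 2 ∧
      Z ^ 2 * c ^ 2 / 4 = F c / 2 ∧ η₂ < c ∧ c < η₁ := by
  have hc0 : 0 < c := by
    refine lt_of_le_of_ne hc fun h => ?_
    rw [hF, ← h] at ha
    have hpos : 0 < η₁ ^ 2 * η₂ ^ 2 := by
      have := h2.trans h21
      positivity
    nlinarith [sq_nonneg a]
  have hZc : Z * c ≠ 0 := mul_ne_zero hZ hc0.ne'
  have hne : a - b ≠ 0 := by
    rw [hab, neg_mul]
    exact neg_ne_zero.mpr hZc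
  have hsum : a + b = 0 := by
    have hprod : (a - b) * (a + b) = 0 := by linear_combination ha - hb
    exact (mul_eq_zero.mp hprod).resolve_left hne
  have ha' : a = -(Z * c) / 2 := by linarith
  have hsq : Z ^ 2 * c ^ 2 / 4 = F c / 2 := by
    rw [← ha, ha']
    ring
  have hFpos : 0 < (η₁ ^ 2 - c ^ 2) * (c ^ 2 - η₂ ^ 2) := by
    rw [← hF]
    have : 0 < Z ^ 2 * c ^ 2 := by positivity
    linarith
  refine ⟨hc0, ha', by linarith, hsq, ?_, ?_⟩
  · by_contra! h
    have h₁ : c ^ 2 ≤ η₂ ^ 2 := by gcongr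
    have h₂ : η₂ ^ 2 ≤ η₁ ^ 2 := by gcongr
    exact hFpos.not_ge (mul_nonpos_of_nonneg_of_nonpos (by linarith) (by linarith))
  · by_contra! h
    have h₁ : η₁ ^ 2 ≤ c ^ 2 := pow_le_pow_left₀ (h2.trans h21).le h 2
    have h₂ : η₂ ^ 2 ≤ η₁ ^ 2 := by gcongr
    exact hFpos.not_ge (mul_nonpos_of_nonpos_of_nonneg (by linarith) (by linarith))
end

section
/- Let Z ≠ 0 and ω > Z²/4, and set θ(ω, Z) = √(ω − Z²/8) − (√2/4)·|Z|. For 0 < η < θ(ω, Z), the discriminant (2ω − Z²/2)² − 4η²(2ω − η²) is strictly positive, and the number Φ(η) ≥ 0 defined by Φ(η)² = [(2ω − Z²/2) + √((2ω − Z²/2)² − 4η²(2ω − η²))]/2 satisfies η < Φ(η) < √(2ω − η²). -/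
/-- For `Z ≠ 0`, `ω > Z²/4`, `θ(ω,Z) = √(ω - Z²/8) - (√2/4)|Z|` and `0 < η < θ(ω,Z)`,
the discriminant `(2ω - Z²/2)² - 4η²(2ω - η²)` is strictly positive, and the value
`Φ(η) ≥ 0` defined by `Φ(η)² = ((2ω - Z²/2) + √disc)/2` satisfies
`η < Φ(η) < √(2ω - η²)`. -/
theorem phi_at_defect_bounds (Z ω : ℝ) (hZ : Z ≠ 0) (hω : Z ^ 2 / 4 < ω)
    (θ : ℝ) (hθ : θ = Real.sqrt (ω - Z ^ 2 / 8) - Real.sqrt 2 / 4 * |Z|)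
    (η : ℝ) (hη0 : 0 < η) (hηθ : η < θ)
    (Φ : ℝ) (hΦ0 : 0 ≤ Φ)
    (hΦ : Φ ^ 2 = ((2 * ω - Z ^ 2 / 2) +
      Real.sqrt ((2 * ω - Z ^ 2 / 2) ^ 2 - 4 * η ^ 2 * (2 * ω - η ^ 2))) / 2) :
    0 < (2 * ω - Z ^ 2 / 2) ^ 2 - 4 * η ^ 2 * (2 * ω - η ^ 2) ∧
      η < Φ ∧ Φ < Real.sqrt (2 * ω - η ^ 2) := by
  obtain ⟨s, hs⟩ : ∃ s, s = Real.sqrt 2 / 4 * |Z| := ⟨_, rfl⟩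
  have hs0 : 0 < s := by
    rw [hs]
    have := abs_pos.mpr hZ
    positivity
  have hZs : Z ^ 2 = 8 * s ^ 2 := by
    rw [hs, mul_pow, div_pow, Real.sq_sqrt (by norm_num), sq_abs]
    ring
  rw [← hs, hZs] at hθ
  rw [hZs] at hΦ ⊢
  have hsum : (η + s) ^ 2 < ω - 8 * s ^ 2 / 8 :=
    (Real.lt_sqrt (by positivity)).mp (by linarith)
  have hηs : 0 < η * s := mul_pos hη0 hs0
  have hp : 2 * (η * s) < ω - 2 * s ^ 2 - η ^ 2 := by nlinarith
  have hdisc : (2 * ω - 8 * s ^ 2 / 2) ^ 2 - 4 * η ^ 2 * (2 * ω - η ^ 2) =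
      4 * ((ω - 2 * s ^ 2 - η ^ 2 - 2 * (η * s)) *
        (ω - 2 * s ^ 2 - η ^ 2 + 2 * (η * s))) := by ring
  have hpos : 0 < (2 * ω - 8 * s ^ 2 / 2) ^ 2 - 4 * η ^ 2 * (2 * ω - η ^ 2) := by
    rw [hdisc]
    exact mul_pos (by norm_num) (mul_pos (by linarith) (by linarith))
  refine ⟨hpos, ?_, ?_⟩
  · refine lt_of_pow_lt_pow_left₀ 2 hΦ0 ?_
    rw [hΦ]
    linarith [Real.sqrt_pos.mpr hpos]
  · rw [Real.lt_sqrt hΦ0, hΦ]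
    have hs2 : 0 < s ^ 2 := by positivity
    have hroot : Real.sqrt ((2 * ω - 8 * s ^ 2 / 2) ^ 2 - 4 * η ^ 2 * (2 * ω - η ^ 2)) <
        2 * (ω + 2 * s ^ 2 - η ^ 2) := by
      rw [Real.sqrt_lt' (by linarith)]
      nlinarith [mul_pos hs2 (show 0 < ω - 2 * s ^ 2 - η ^ 2 by linarith),
        sq_nonneg (s ^ 2), sq_nonneg (η * s)]
    linarith
end

section
/- Let p > 0, Z ∈ ℝ, and ω > Z²/4. Define φ : ℝ → ℝ by φ(x) = [((p+2)·ω/2)·sech²((p·√ω/2)·|x| + arctanh(Z/(2√ω)))]^{1/p}. Then φ is continuous and strictly positive on ℝ, smooth on ℝ ∖ {0}, satisfies −φ''(x) + ω·φ(x) − φ(x)^{p+1} = 0 for all x ≠ 0, and its one-sided derivatives at 0 exist and satisfy φ'(0+) − φ'(0−) = −Z·φ(0). -/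
open Filter Set

/-- The inverse hyperbolic tangent. -/
noncomputable def arctanh (x : ℝ) : ℝ := Real.log ((1 + x) / (1 - x)) / 2

theorem tanh_arctanh {x : ℝ} (hx : x ∈ Ioo (-1 : ℝ) 1) : Real.tanh (arctanh x) = x := by
  have h : arctanh x = Real.artanh x := by
    rw [arctanh, Real.artanh_eq_half_log (Ioo_subset_Icc_self hx)]
    ring
  rw [h, Real.tanh_artanh hx]

theorem hasDerivAt_tanh (x : ℝ) : HasDerivAt Real.tanh ((1 / Real.cosh x) ^ 2) x := by
  have hc := (Real.cosh_pos x).ne'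
  have h := (Real.hasDerivAt_sinh x).div (Real.hasDerivAt_cosh x) hc
  have hf : Real.tanh = Real.sinh / Real.cosh := by
    ext y
    simp [Real.tanh_eq_sinh_div_cosh]
  rw [hf]
  refine h.congr_deriv ?_
  field_simp
  linarith [Real.cosh_sq x]

/-- The profile `x ↦ (A sech²(k x + b))^{1/p}`. -/
noncomputable def sechProfile (p A k b x : ℝ) : ℝ :=
  (A * (1 / Real.cosh (k * x + b)) ^ 2) ^ (1 / p)

theorem sechProfile_base_pos {A : ℝ} (hA : 0 < A) (y : ℝ) :
    0 < A * (1 / Real.cosh y) ^ 2 := by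
  have := Real.cosh_pos y
  positivity

theorem sechProfile_pos {A : ℝ} (p k b x : ℝ) (hA : 0 < A) : 0 < sechProfile p A k b x :=
  Real.rpow_pos_of_pos (sechProfile_base_pos hA _) _

theorem contDiff_sechProfile {A : ℝ} (p k b : ℝ) (hA : 0 < A) {n : WithTop ℕ∞} :
    ContDiff ℝ n (sechProfile p A k b) := by
  have hc : ContDiff ℝ n fun x => Real.cosh (k * x + b) :=
    Real.contDiff_cosh.comp ((contDiff_const.mul contDiff_id).add contDiff_const)
  refine ContDiff.rpow_const_of_ne ?_ fun x => (sechProfile_base_pos hA _).ne'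
  exact contDiff_const.mul ((contDiff_const.div hc fun x => (Real.cosh_pos _).ne').pow 2)

theorem hasDerivAt_sechProfile {p A : ℝ} (k b x : ℝ) (hp : p ≠ 0) (hA : 0 < A) :
    HasDerivAt (sechProfile p A k b)
      (-(2 * k / p) * Real.tanh (k * x + b) * sechProfile p A k b x) x := by
  have hc := (Real.cosh_pos (k * x + b)).ne'
  have hl : HasDerivAt (fun x => k * x + b) k x := by
    simpa using ((hasDerivAt_id x).const_mul k).add_const b
  have hb := sechProfile_base_pos hA (k * x + b)
  have h := (((((Real.hasDerivAt_cosh _).comp x hl).inv hc).pow 2).const_mul A).rpow_const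
    (p := 1 / p) (Or.inl (by simpa using hb.ne'))
  have hf : sechProfile p A k b =
      fun x => (A * ((Real.cosh ∘ fun x => k * x + b)⁻¹ ^ 2) x) ^ (1 / p) := by
    ext y
    simp [sechProfile]
  rw [hf]
  convert h using 1
  have hr := Real.rpow_sub_one hb.ne' (1 / p)
  simp only [Function.comp, Pi.inv_apply, Pi.pow_apply, one_div] at hr ⊢
  rw [hr, Real.tanh_eq_sinh_div_cosh]
  push_cast
  norm_num only [pow_one]
  field_simp

theorem deriv_sechProfile {p A : ℝ} (k b : ℝ) (hp : p ≠ 0) (hA : 0 < A) :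
    deriv (sechProfile p A k b) =
      fun x => -(2 * k / p) * Real.tanh (k * x + b) * sechProfile p A k b x :=
  funext fun x => (hasDerivAt_sechProfile k b x hp hA).deriv

theorem sechProfile_ode {p ω k : ℝ} (b x : ℝ) (hp : 0 < p) (hω : 0 < ω)
    (hk : 4 * k ^ 2 = p ^ 2 * ω) :
    -(deriv (deriv (sechProfile p ((p + 2) * ω / 2) k b)) x) +
      ω * sechProfile p ((p + 2) * ω / 2) k b x -
      sechProfile p ((p + 2) * ω / 2) k b x ^ (p + 1) = 0 := by
  have hA : 0 < (p + 2) * ω / 2 := by positivity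
  have hc := (Real.cosh_pos (k * x + b)).ne'
  have hl : HasDerivAt (fun x => k * x + b) k x := by
    simpa using ((hasDerivAt_id x).const_mul k).add_const b
  have h := (((hasDerivAt_tanh _).comp x hl).const_mul (-(2 * k / p))).mul
    (hasDerivAt_sechProfile k b x hp.ne' hA)
  have hd := h.deriv
  rw [deriv_sechProfile k b hp.ne' hA]
  have hpow : sechProfile p ((p + 2) * ω / 2) k b x ^ (p + 1) =
      (p + 2) * ω / 2 * (1 / Real.cosh (k * x + b)) ^ 2 *
        sechProfile p ((p + 2) * ω / 2) k b x := by
    rw [Real.rpow_add (sechProfile_pos p k b x hA), Real.rpow_one]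
    congr 1
    rw [sechProfile, ← Real.rpow_mul (sechProfile_base_pos hA _).le, one_div_mul_cancel hp.ne',
      Real.rpow_one]
  rw [hpow]
  refine (congrArg (fun d => -d + ω * sechProfile p ((p + 2) * ω / 2) k b x - _) hd).trans ?_
  have ht : Real.tanh (k * x + b) ^ 2 = 1 - (1 / Real.cosh (k * x + b)) ^ 2 := by
    rw [Real.tanh_eq_sinh_div_cosh]
    field_simp
    linarith [Real.cosh_sq (k * x + b)]
  have hω' : ω = 4 * k ^ 2 / p ^ 2 := by
    field_simp
    linarith
  simp only [Function.comp]
  generalize sechProfile p ((p + 2) * ω / 2) k b x = g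
  generalize (1 / Real.cosh (k * x + b)) = s at *
  generalize Real.tanh (k * x + b) = t at *
  rw [hω']
  field_simp
  linear_combination (-8 * k ^ 2 * g) * ht

theorem tendsto_deriv_sechProfile {p A : ℝ} (k b : ℝ) (hp : p ≠ 0) (hA : 0 < A) :
    Tendsto (deriv (sechProfile p A k b)) (nhds 0)
      (nhds (-(2 * k / p) * Real.tanh b * sechProfile p A k b 0)) := by
  have h := ((contDiff_sechProfile p k b hA (n := 1)).continuous_deriv le_rfl).tendsto 0
  rwa [(hasDerivAt_sechProfile k b 0 hp hA).deriv, mul_zero, zero_add] at h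

/-- The explicit standing-wave profile for NLS with a δ-interaction of strength `Z` on the
line: for `p > 0` and `ω > Z²/4`,
`φ(x) = [((p+2)ω/2) sech²((p√ω/2)|x| + arctanh(Z/(2√ω)))]^{1/p}` is continuous, strictly
positive, smooth off the origin, solves `-φ'' + ω φ - φ^{p+1} = 0` for `x ≠ 0`, and its
one-sided derivatives at `0` exist with jump `φ'(0+) - φ'(0-) = -Z φ(0)`. -/
theorem solitary_peak_profile (p Z ω : ℝ) (hp : 0 < p) (hω : Z ^ 2 / 4 < ω)
    (φ : ℝ → ℝ)
    (hφ : ∀ x : ℝ, φ x = (((p + 2) * ω / 2) *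
      (1 / Real.cosh ((p * Real.sqrt ω / 2) * |x| +
        arctanh (Z / (2 * Real.sqrt ω)))) ^ 2) ^ (1 / p)) :
    Continuous φ ∧ (∀ x : ℝ, 0 < φ x) ∧
    ContDiffOn ℝ (⊤ : ℕ∞) φ {x : ℝ | x ≠ 0} ∧
    (∀ x : ℝ, x ≠ 0 → -(deriv (deriv φ) x) + ω * φ x - φ x ^ (p + 1) = 0) ∧
    (∃ a b : ℝ, Tendsto (deriv φ) (nhdsWithin 0 (Set.Ioi 0)) (nhds a) ∧
      Tendsto (deriv φ) (nhdsWithin 0 (Set.Iio 0)) (nhds b) ∧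
      a - b = -Z * φ 0) := by
  have hω0 : 0 < ω := lt_of_le_of_lt (by positivity) hω
  have hA : 0 < (p + 2) * ω / 2 := by positivity
  have hs : 0 < Real.sqrt ω := Real.sqrt_pos.2 hω0
  have hss : Real.sqrt ω ^ 2 = ω := Real.sq_sqrt hω0.le
  have hZ : |Z| < 2 * Real.sqrt ω := abs_lt_of_sq_lt_sq (by nlinarith) (by positivity)
  have htanh : Real.tanh (arctanh (Z / (2 * Real.sqrt ω))) = Z / (2 * Real.sqrt ω) := by
    obtain ⟨h₁, h₂⟩ := abs_lt.1 hZ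
    refine tanh_arctanh ⟨?_, ?_⟩
    · rw [lt_div_iff₀ (by positivity)]
      linarith
    · rw [div_lt_one (by positivity)]
      exact h₂
  set A := (p + 2) * ω / 2 with hAdef
  set k := p * Real.sqrt ω / 2 with hkdef
  set b := arctanh (Z / (2 * Real.sqrt ω)) with hbdef
  have hk : 4 * k ^ 2 = p ^ 2 * ω := by
    rw [hkdef]
    linear_combination p ^ 2 * hss
  have hφabs : φ = fun x => sechProfile p A k b |x| := funext hφ
  have hright : EqOn φ (sechProfile p A k b) (Ioi 0) := fun x hx => by
    rw [hφabs]
    simp only [abs_of_pos (mem_Ioi.1 hx)]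
  have hleft : EqOn φ (sechProfile p A (-k) b) (Iio 0) := fun x hx => by
    rw [hφabs]
    simp only [abs_of_neg (mem_Iio.1 hx), sechProfile, mul_neg, neg_mul]
  have hloc : ∀ x ≠ 0, ∃ κ, 4 * κ ^ 2 = p ^ 2 * ω ∧ φ =ᶠ[nhds x] sechProfile p A κ b := by
    intro x hx
    rcases hx.lt_or_gt with hx | hx
    · exact ⟨-k, by rw [neg_sq, hk], hleft.eventuallyEq_of_mem (Iio_mem_nhds hx)⟩
    · exact ⟨k, hk, hright.eventuallyEq_of_mem (Ioi_mem_nhds hx)⟩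
  have hφ0 : ∀ κ, sechProfile p A κ b 0 = φ 0 := fun κ => by
    simp [hφabs, sechProfile]
  refine ⟨?_, ?_, ?_, ?_, ?_⟩
  · rw [hφabs]
    exact (contDiff_sechProfile p k b hA (n := 0)).continuous.comp continuous_abs
  · intro x
    rw [hφabs]
    exact sechProfile_pos p k b _ hA
  · intro x hx
    obtain ⟨κ, -, hκ⟩ := hloc x hx
    exact ((contDiff_sechProfile p κ b hA).contDiffAt.congr_of_eventuallyEq hκ).contDiffWithinAt
  · intro x hx
    obtain ⟨κ, hκ, hκ'⟩ := hloc x hx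
    rw [hκ'.deriv.deriv_eq, hκ'.eq_of_nhds]
    exact sechProfile_ode b x hp hω0 hκ
  · refine ⟨_, _,
      ((tendsto_deriv_sechProfile k b hp.ne' hA).mono_left nhdsWithin_le_nhds).congr' ?_,
      ((tendsto_deriv_sechProfile (-k) b hp.ne' hA).mono_left nhdsWithin_le_nhds).congr' ?_, ?_⟩
    · exact ((hright.deriv isOpen_Ioi).eventuallyEq_of_mem self_mem_nhdsWithin).symm
    · exact ((hleft.deriv isOpen_Iio).eventuallyEq_of_mem self_mem_nhdsWithin).symm
    · rw [hφ0, hφ0, htanh, hkdef]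
      field_simp
      ring
end

section
/- For 0 < k < 1 define the complete elliptic integrals K(k) = ∫₀^{π/2} (1 − k²·sin²θ)^{−1/2} dθ and E(k) = ∫₀^{π/2} (1 − k²·sin²θ)^{1/2} dθ. Then both k ↦ K(k) + E(k) and k ↦ K(k)·E(k) − (K(k) + E(k))/2 are strictly increasing on (0, 1). -/
open Real Set MeasureTheory

/-- `∫₀^{π/2} (1 - k² sin²θ)^p dθ`. -/
noncomputable def ellipticIntegral (p k : ℝ) : ℝ :=
  ∫ θ in (0:ℝ)..(π / 2), (1 - k ^ 2 * sin θ ^ 2) ^ p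

theorem one_sub_sq_le_one_sub_sq_mul_sin_sq (k θ : ℝ) :
    1 - k ^ 2 ≤ 1 - k ^ 2 * sin θ ^ 2 := by
  nlinarith [mul_nonneg (sq_nonneg k) (sq_nonneg (cos θ)), sin_sq_add_cos_sq θ]

theorem one_sub_sq_pos {k : ℝ} (hk : k ∈ Ioo (0:ℝ) 1) : 0 < 1 - k ^ 2 := by
  nlinarith [hk.1, hk.2]

theorem one_sub_sq_mul_sin_sq_pos {k : ℝ} (hk : k ∈ Ioo (0:ℝ) 1) (θ : ℝ) :
    0 < 1 - k ^ 2 * sin θ ^ 2 :=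
  (one_sub_sq_pos hk).trans_le (one_sub_sq_le_one_sub_sq_mul_sin_sq k θ)

theorem continuous_one_sub_sq_mul_sin_sq_rpow {k : ℝ} (hk : k ∈ Ioo (0:ℝ) 1) (p : ℝ) :
    Continuous fun θ => (1 - k ^ 2 * sin θ ^ 2) ^ p :=
  Continuous.rpow_const (by fun_prop) fun θ => Or.inl (one_sub_sq_mul_sin_sq_pos hk θ).ne'

theorem hasDerivAt_ellipticIntegral (p : ℝ) {k : ℝ} (hk : k ∈ Ioo (0:ℝ) 1) :
    HasDerivAt (ellipticIntegral p)
      (2 * p / k * (ellipticIntegral p k - ellipticIntegral (p - 1) k)) k := by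
  obtain ⟨r, hkr, hr⟩ := exists_between hk.2
  have hpos : ∀ x ∈ Ioo 0 r, x ∈ Ioo (0:ℝ) 1 := fun x hx => ⟨hx.1, hx.2.trans hr⟩
  let F' : ℝ → ℝ → ℝ := fun x θ =>
    -(2 * x * sin θ ^ 2) * p * (1 - x ^ 2 * sin θ ^ 2) ^ (p - 1)
  have hF' : ∀ θ, ∀ x ∈ Ioo 0 r,
      HasDerivAt (fun x => (1 - x ^ 2 * sin θ ^ 2) ^ p) (F' x θ) x := by
    intro θ x hx
    have h : HasDerivAt (fun x : ℝ => 1 - x ^ 2 * sin θ ^ 2) (-(2 * x * sin θ ^ 2)) x := by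
      simpa using ((hasDerivAt_pow 2 x).mul_const (sin θ ^ 2)).const_sub 1
    exact h.rpow_const (Or.inl (one_sub_sq_mul_sin_sq_pos (hpos x hx) θ).ne')
  have hcont : ContinuousOn (fun z : ℝ × ℝ => F' z.1 z.2) (Icc 0 r ×ˢ Icc 0 (π / 2)) := by
    refine ContinuousOn.mul (by fun_prop) (ContinuousOn.rpow_const (by fun_prop) ?_)
    rintro ⟨x, θ⟩ ⟨hx, -⟩
    left
    have := one_sub_sq_le_one_sub_sq_mul_sin_sq x θ
    simp only [mem_Icc] at hx
    have : 0 < 1 - x ^ 2 := by nlinarith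
    dsimp only
    linarith
  obtain ⟨C, hC⟩ := (isCompact_Icc.prod isCompact_Icc).exists_bound_of_continuousOn hcont
  have hker := continuous_one_sub_sq_mul_sin_sq_rpow hk
  have key := (intervalIntegral.hasDerivAt_integral_of_dominated_loc_of_deriv_le
    (μ := volume) (a := 0) (b := π / 2) (F := fun x θ => (1 - x ^ 2 * sin θ ^ 2) ^ p) (F' := F')
    (bound := fun _ => C) (Ioo_mem_nhds hk.1 hkr)
    (by
      filter_upwards [Ioo_mem_nhds hk.1 hkr] with x hx
      exact (continuous_one_sub_sq_mul_sin_sq_rpow (hpos x hx) p).aestronglyMeasurable)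
    ((hker p).intervalIntegrable _ _)
    (Continuous.aestronglyMeasurable (Continuous.mul (by fun_prop) (hker (p - 1))))
    (by
      refine Filter.Eventually.of_forall fun θ hθ x hx => hC (x, θ) ⟨Ioo_subset_Icc_self hx, ?_⟩
      rw [uIoc_of_le (by positivity)] at hθ
      exact Ioc_subset_Icc_self hθ)
    intervalIntegrable_const
    (Filter.Eventually.of_forall fun θ _ x hx => hF' θ x hx)).2
  refine key.congr_deriv ?_
  unfold ellipticIntegral
  rw [← intervalIntegral.integral_sub ((hker p).intervalIntegrable _ _)
    ((hker (p - 1)).intervalIntegrable _ _), ← intervalIntegral.integral_const_mul]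
  refine intervalIntegral.integral_congr fun θ _ => ?_
  have hk0 := hk.1.ne'
  have hX := one_sub_sq_mul_sin_sq_pos hk θ
  have hp : (1 - k ^ 2 * sin θ ^ 2) ^ p
      = (1 - k ^ 2 * sin θ ^ 2) ^ (p - 1) * (1 - k ^ 2 * sin θ ^ 2) := by
    rw [rpow_sub_one hX.ne', div_mul_cancel₀ _ hX.ne']
  simp only [F', hp]
  field_simp
  ring

theorem ellipticIntegral_neg_three_halves {k : ℝ} (hk : k ∈ Ioo (0:ℝ) 1) :
    (1 - k ^ 2) * ellipticIntegral (-(3 / 2)) k = ellipticIntegral (1 / 2) k := by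
  have hker := continuous_one_sub_sq_mul_sin_sq_rpow hk
  have hderiv : ∀ θ : ℝ, HasDerivAt
      (fun θ => k ^ 2 * (sin θ * cos θ * (1 - k ^ 2 * sin θ ^ 2) ^ (-(1 / 2) : ℝ)))
      ((1 - k ^ 2 * sin θ ^ 2) ^ (1 / 2 : ℝ)
        - (1 - k ^ 2) * (1 - k ^ 2 * sin θ ^ 2) ^ (-(3 / 2) : ℝ)) θ := by
    intro θ
    have hX := one_sub_sq_mul_sin_sq_pos hk θ
    have h : HasDerivAt (fun θ : ℝ => 1 - k ^ 2 * sin θ ^ 2)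
        (-(k ^ 2 * (2 * sin θ * cos θ))) θ := by
      simpa using (((hasDerivAt_sin θ).pow 2).const_mul (k ^ 2)).const_sub 1
    refine ((((hasDerivAt_sin θ).mul (hasDerivAt_cos θ)).mul
      (h.rpow_const (p := -(1 / 2)) (Or.inl hX.ne'))).const_mul (k ^ 2)).congr_deriv ?_
    have h1 : (1 - k ^ 2 * sin θ ^ 2) ^ (-(1 / 2) : ℝ)
        = (1 - k ^ 2 * sin θ ^ 2) ^ (-(3 / 2) : ℝ) * (1 - k ^ 2 * sin θ ^ 2) := by
      rw [← rpow_add_one hX.ne']; norm_num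
    have h2 : (1 - k ^ 2 * sin θ ^ 2) ^ (1 / 2 : ℝ)
        = (1 - k ^ 2 * sin θ ^ 2) ^ (-(1 / 2) : ℝ) * (1 - k ^ 2 * sin θ ^ 2) := by
      rw [← rpow_add_one hX.ne']; norm_num
    have h3 : (-(1 / 2) - 1 : ℝ) = -(3 / 2) := by norm_num
    rw [h3, h2, h1]
    have hc : cos θ ^ 2 = 1 - sin θ ^ 2 := cos_sq' θ
    simp only [Pi.mul_apply]
    ring_nf
    rw [hc]
    ring
  have hftc := intervalIntegral.integral_eq_sub_of_hasDerivAt (a := 0) (b := π / 2)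
    (fun θ _ => hderiv θ)
    (((hker _).sub (continuous_const.mul (hker _))).intervalIntegrable _ _)
  rw [intervalIntegral.integral_sub ((hker _).intervalIntegrable _ _)
    (((hker _).intervalIntegrable _ _).const_mul _),
    intervalIntegral.integral_const_mul] at hftc
  simp only [cos_pi_div_two, sin_zero, mul_zero, zero_mul, sub_zero] at hftc
  unfold ellipticIntegral
  linarith

theorem pi_div_two_le_ellipticIntegral_neg_half {k : ℝ} (hk : k ∈ Ioo (0:ℝ) 1) :
    π / 2 ≤ ellipticIntegral (-(1 / 2)) k := by
  have h : ∫ _ in (0:ℝ)..(π / 2), (1:ℝ) ≤ ellipticIntegral (-(1 / 2)) k := by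
    refine intervalIntegral.integral_mono_on (by positivity) intervalIntegrable_const
      ((continuous_one_sub_sq_mul_sin_sq_rpow hk _).intervalIntegrable _ _) fun θ _ => ?_
    exact one_le_rpow_of_pos_of_le_one_of_nonpos (one_sub_sq_mul_sin_sq_pos hk θ)
      (sub_le_self _ (by positivity)) (by norm_num)
  simpa using h

theorem le_ellipticIntegral_half {k : ℝ} (hk : k ∈ Ioo (0:ℝ) 1) :
    π / 4 * (2 - k ^ 2) ≤ ellipticIntegral (1 / 2) k := by
  have h : ∫ θ in (0:ℝ)..(π / 2), (1 - k ^ 2 * sin θ ^ 2) ≤ ellipticIntegral (1 / 2) k := by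
    refine intervalIntegral.integral_mono_on (by positivity)
      (Continuous.intervalIntegrable (by fun_prop) _ _)
      ((continuous_one_sub_sq_mul_sin_sq_rpow hk _).intervalIntegrable _ _) fun θ _ => ?_
    exact self_le_rpow_of_le_one (one_sub_sq_mul_sin_sq_pos hk θ).le
      (sub_le_self _ (by positivity)) (by norm_num)
  refine le_trans (le_of_eq ?_) h
  rw [intervalIntegral.integral_sub intervalIntegrable_const
    (Continuous.intervalIntegrable (by fun_prop) _ _), intervalIntegral.integral_const_mul,
    integral_sin_sq]
  simp
  ring

/-- For `u² + v² = 1 + c²` and `uv ≥ c`, a lower bound for `(u - c / u) + (v - c / v)`. -/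
theorem le_sub_div_add_sub_div {c u v : ℝ} (hc : 0 < c) (hu : 0 < u) (hv : 0 < v)
    (huv : u ^ 2 + v ^ 2 = 1 + c ^ 2) (hcuv : c ≤ u * v) :
    4 * ((u * v) ^ 2 - c ^ 2) / ((1 + c) * (1 + c ^ 2)) ≤ (u - c * u⁻¹) + (v - c * v⁻¹) := by
  have hw : u * v ≤ (1 + c ^ 2) / 2 := by nlinarith [sq_nonneg (u - v)]
  have hsum : 1 + c ≤ u + v := by nlinarith
  have hw0 : 0 < u * v := mul_pos hu hv
  have e : (u - c * u⁻¹) + (v - c * v⁻¹)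
      = (u + v) * ((u * v) ^ 2 - c ^ 2) / (u * v * (u * v + c)) := by
    have : u * v + c ≠ 0 := by positivity
    field_simp
    ring
  have hnum : 0 ≤ (u * v) ^ 2 - c ^ 2 := by nlinarith
  have hden : u * v * (u * v + c) ≤ (1 + c ^ 2) / 2 * ((1 + c) ^ 2 / 2) := by
    apply mul_le_mul hw _ (by positivity) (by positivity)
    linarith
  rw [e]
  calc 4 * ((u * v) ^ 2 - c ^ 2) / ((1 + c) * (1 + c ^ 2))
      = (1 + c) * ((u * v) ^ 2 - c ^ 2) / ((1 + c ^ 2) / 2 * ((1 + c) ^ 2 / 2)) := by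
        field_simp; ring
    _ ≤ _ := by gcongr

theorem le_ellipticIntegral_half_sub {k c : ℝ} (hk : k ∈ Ioo (0:ℝ) 1) (hc : 0 < c)
    (hck : c ^ 2 = 1 - k ^ 2) :
    π / 8 * ((1 - c) ^ 2 * (1 + c) / (1 + c ^ 2)) ≤
      ellipticIntegral (1 / 2) k - c * ellipticIntegral (-(1 / 2)) k := by
  have hker := continuous_one_sub_sq_mul_sin_sq_rpow hk
  let f : ℝ → ℝ := fun θ => (1 - k ^ 2 * sin θ ^ 2) ^ (1 / 2 : ℝ)
    - c * (1 - k ^ 2 * sin θ ^ 2) ^ (-(1 / 2) : ℝ)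
  have hf : Continuous f := (hker _).sub (continuous_const.mul (hker _))
  have hfi : ∫ θ in (0:ℝ)..(π / 2), f θ =
      ellipticIntegral (1 / 2) k - c * ellipticIntegral (-(1 / 2)) k := by
    unfold ellipticIntegral
    rw [← intervalIntegral.integral_const_mul, ← intervalIntegral.integral_sub
      ((hker _).intervalIntegrable _ _)
      (((hker _).intervalIntegrable _ _).const_mul _)]
  have hf' : Continuous fun θ => f (π / 2 - θ) := hf.comp (by fun_prop)
  have hsymm : ∫ θ in (0:ℝ)..(π / 2), f (π / 2 - θ) = ∫ θ in (0:ℝ)..(π / 2), f θ := by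
    simp [intervalIntegral.integral_comp_sub_left]
  have hle : ∫ θ in (0:ℝ)..(π / 2),
      4 * k ^ 4 / ((1 + c) * (1 + c ^ 2)) * (sin θ ^ 2 * cos θ ^ 2) ≤
      ∫ θ in (0:ℝ)..(π / 2), (f θ + f (π / 2 - θ)) := by
    refine intervalIntegral.integral_mono_on (by positivity)
      (Continuous.intervalIntegrable (by fun_prop) _ _)
      ((hf.add hf').intervalIntegrable _ _) fun θ _ => ?_
    have hu := one_sub_sq_mul_sin_sq_pos hk θ
    have hv := one_sub_sq_mul_sin_sq_pos hk (π / 2 - θ)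
    simp only [f]
    rw [sin_pi_div_two_sub] at hv ⊢
    simp only [rpow_neg hu.le, rpow_neg hv.le, ← sqrt_eq_rpow]
    have hsc := sin_sq_add_cos_sq θ
    have hprod : (√(1 - k ^ 2 * sin θ ^ 2) * √(1 - k ^ 2 * cos θ ^ 2)) ^ 2
        = c ^ 2 + k ^ 4 * (sin θ ^ 2 * cos θ ^ 2) := by
      rw [mul_pow, sq_sqrt hu.le, sq_sqrt hv.le]
      linear_combination -k ^ 2 * hsc - hck
    refine le_trans (le_of_eq ?_) (le_sub_div_add_sub_div hc (sqrt_pos.2 hu) (sqrt_pos.2 hv) ?_ ?_)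
    · rw [hprod]
      ring
    · rw [sq_sqrt hu.le, sq_sqrt hv.le]
      linear_combination -k ^ 2 * hsc - hck
    · refine le_of_sq_le_sq ?_ (by positivity)
      rw [hprod]
      exact le_add_of_nonneg_right (by positivity)
  rw [intervalIntegral.integral_add (hf.intervalIntegrable _ _) (hf'.intervalIntegrable _ _),
    hsymm, hfi, intervalIntegral.integral_const_mul, integral_sin_sq_mul_cos_sq] at hle
  have h4 : sin (4 * (π / 2)) = 0 := by
    rw [show 4 * (π / 2) = 2 * π by ring, sin_two_pi]
  have hk4 : k ^ 4 = (1 - c) ^ 2 * (1 + c) ^ 2 := by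
    rw [show k ^ 4 = (1 - c ^ 2) ^ 2 by rw [hck]; ring]; ring
  rw [h4, hk4] at hle
  have e : 4 * ((1 - c) ^ 2 * (1 + c) ^ 2) / ((1 + c) * (1 + c ^ 2)) *
      ((π / 2 - 0) / 8 - (0 - sin (4 * 0)) / 32)
      = 2 * (π / 8 * ((1 - c) ^ 2 * (1 + c) / (1 + c ^ 2))) := by
    simp only [mul_zero, sin_zero]
    field_simp
    ring
  rw [e] at hle
  linarith

/-- The inequality between `P = E + cK`, `Q = E - cK` behind both monotonicity claims. -/
theorem lt_two_mul_mul_of_bounds {c P Q : ℝ} (hc0 : 0 < c) (hc1 : c < 1)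
    (hP : π / 4 * (1 + c) ^ 2 ≤ P)
    (hQ : π / 8 * ((1 - c) ^ 2 * (1 + c) / (1 + c ^ 2)) ≤ Q) :
    P * (1 - c) ^ 2 / 2 + Q * (1 + c) ^ 2 / 2 < 2 * (P * Q) := by
  have hpi := pi_gt_three
  have hq : π / 8 ≤ π / 8 * ((1 + c) / (1 + c ^ 2)) := by
    refine le_mul_of_one_le_right (by positivity) ?_
    rw [one_le_div (by positivity)]
    nlinarith
  have hQ' : π / 8 * (1 - c) ^ 2 ≤ Q := by
    refine le_trans ?_ hQ
    calc π / 8 * (1 - c) ^ 2 ≤ π / 8 * ((1 + c) / (1 + c ^ 2)) * (1 - c) ^ 2 := by gcongr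
      _ = _ := by ring
  have hd : 0 < (1 - c) ^ 2 := by have := sub_pos.2 hc1; positivity
  have hcoef : 0 < 2 * P - (1 + c) ^ 2 / 2 := by nlinarith [sq_pos_of_pos (by linarith : 0 < 1 + c)]
  have h1 := mul_le_mul_of_nonneg_right hQ' hcoef.le
  have h2 : 0 < π / 8 * (2 * P - (1 + c) ^ 2 / 2) - P / 2 := by
    have hcc : 0 < (1 + c) ^ 2 := by positivity
    nlinarith [mul_le_mul_of_nonneg_left hP (by linarith : 0 ≤ π / 4 - 1 / 2), mul_pos pi_pos hcc]
  nlinarith [mul_pos hd h2]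


/-- Monotonicity of combinations of the complete elliptic integrals
`K(k) = ∫₀^{π/2} (1 - k² sin²θ)^{-1/2} dθ` and `E(k) = ∫₀^{π/2} (1 - k² sin²θ)^{1/2} dθ`:
both `k ↦ K(k) + E(k)` and `k ↦ K(k)E(k) - (K(k) + E(k))/2` are strictly increasing
on `(0, 1)`. -/
theorem elliptic_integrals_monotone (K E : ℝ → ℝ)
    (hK : ∀ k : ℝ, K k = ∫ θ in (0:ℝ)..(Real.pi / 2),
      (1 - k ^ 2 * Real.sin θ ^ 2) ^ (-(1/2) : ℝ))
    (hE : ∀ k : ℝ, E k = ∫ θ in (0:ℝ)..(Real.pi / 2),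
      (1 - k ^ 2 * Real.sin θ ^ 2) ^ ((1/2) : ℝ)) :
    StrictMonoOn (fun k => K k + E k) (Set.Ioo (0:ℝ) 1) ∧
    StrictMonoOn (fun k => K k * E k - (K k + E k) / 2) (Set.Ioo (0:ℝ) 1) := by
  obtain rfl : K = ellipticIntegral (-(1 / 2)) := funext hK
  obtain rfl : E = ellipticIntegral (1 / 2) := funext hE
  set K := ellipticIntegral (-(1 / 2))
  set E := ellipticIntegral (1 / 2)
  have hK' : ∀ k ∈ Ioo (0:ℝ) 1, HasDerivAt K ((E k / (1 - k ^ 2) - K k) / k) k := by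
    intro k hk
    refine (hasDerivAt_ellipticIntegral (-(1 / 2)) hk).congr_deriv ?_
    have h := one_sub_sq_pos hk
    rw [show (-(1 / 2) - 1 : ℝ) = -(3 / 2) by norm_num,
      show E k = _ from (ellipticIntegral_neg_three_halves hk).symm,
      mul_div_cancel_left₀ _ h.ne']
    ring
  have hE' : ∀ k ∈ Ioo (0:ℝ) 1, HasDerivAt E ((E k - K k) / k) k := by
    intro k hk
    refine (hasDerivAt_ellipticIntegral (1 / 2) hk).congr_deriv ?_
    rw [show (1 / 2 - 1 : ℝ) = -(1 / 2) by norm_num]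
    ring
  have hmono : ∀ f f' : ℝ → ℝ, (∀ k ∈ Ioo (0:ℝ) 1, HasDerivAt f (f' k) k) →
      (∀ k ∈ Ioo (0:ℝ) 1, 0 < f' k) → StrictMonoOn f (Ioo 0 1) := by
    intro f f' hf hpos
    refine strictMonoOn_of_deriv_pos (convex_Ioo 0 1)
      (fun k hk => (hf k hk).continuousAt.continuousWithinAt) fun k hk => ?_
    rw [interior_Ioo] at hk
    rw [(hf k hk).deriv]
    exact hpos k hk
  have hbounds : ∀ k ∈ Ioo (0:ℝ) 1, ∃ c, 0 < c ∧ c < 1 ∧ k ^ 2 = 1 - c ^ 2 ∧ 0 < K k ∧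
      π / 4 * (1 + c) ^ 2 ≤ E k + c * K k ∧
      π / 8 * ((1 - c) ^ 2 * (1 + c) / (1 + c ^ 2)) ≤ E k - c * K k := by
    intro k hk
    have h := one_sub_sq_pos hk
    have hc := sqrt_pos.2 h
    have hsq := sq_sqrt h.le
    have hKk : π / 2 ≤ K k := pi_div_two_le_ellipticIntegral_neg_half hk
    have hEk : π / 4 * (2 - k ^ 2) ≤ E k := le_ellipticIntegral_half hk
    refine ⟨√(1 - k ^ 2), hc, ?_, by linarith, pi_div_two_pos.trans_le hKk, ?_,
      le_ellipticIntegral_half_sub hk hc hsq⟩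
    · rw [sqrt_lt' one_pos]
      nlinarith [hk.1]
    · linear_combination hEk + mul_le_mul_of_nonneg_left hKk hc.le + π / 4 * hsq
  refine ⟨hmono _ _ (fun k hk => (hK' k hk).add (hE' k hk)) fun k hk => ?_,
    hmono _ _ (fun k hk => ((hK' k hk).mul (hE' k hk)).sub
      (((hK' k hk).add (hE' k hk)).div_const 2)) fun k hk => ?_⟩
  · obtain ⟨c, hc0, hc1, hkc, hKpos, -, hQ⟩ := hbounds k hk
    have hk0 := hk.1
    have hd := sub_pos.2 hc1
    have hQ0 : 0 < E k - c * K k := lt_of_lt_of_le (by positivity) hQ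
    have e : (E k / (1 - k ^ 2) - K k) / k + (E k - K k) / k
        = ((1 + c ^ 2) * (E k - c * K k) + c * K k * (1 - c) ^ 2) / (k * c ^ 2) := by
      rw [hkc, sub_sub_cancel]
      field_simp
      ring
    rw [e]
    positivity
  · obtain ⟨c, hc0, hc1, hkc, -, hP, hQ⟩ := hbounds k hk
    have hk0 := hk.1
    have key := lt_two_mul_mul_of_bounds hc0 hc1 hP hQ
    have e : (E k / (1 - k ^ 2) - K k) / k * E k + K k * ((E k - K k) / k)
          - ((E k / (1 - k ^ 2) - K k) / k + (E k - K k) / k) / 2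
        = (2 * ((E k + c * K k) * (E k - c * K k)) - ((E k + c * K k) * (1 - c) ^ 2 / 2
          + (E k - c * K k) * (1 + c) ^ 2 / 2)) / (2 * (k * c ^ 2)) := by
      rw [hkc, sub_sub_cancel]
      field_simp
      ring
    rw [e]
    exact div_pos (sub_pos.2 key) (by positivity)
end

section
/- Let L > 0, Z ≠ 0, ω, λ ∈ ℝ, and let φ : ℝ → ℝ be continuous and even. Call a function w : ℝ → ℝ admissible if w is 2L-periodic, continuous on ℝ, twice continuously differentiable on ℝ ∖ 2Lℤ, its one-sided derivatives at 0 exist and satisfy w'(0+) − w'(0−) = −Z·w(0), and −w''(x) + ω·w(x) − 3·φ(x)²·w(x) = λ·w(x) for all x ∈ ℝ ∖ 2Lℤ. Suppose v is a nonzero admissible function such that every admissible function w equals β·v for some β ∈ ℝ (i.e., λ is a simple eigenvalue). Then v is either an even function or an odd function. -/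
open Filter Set

/-- `w : ℝ → ℝ` is an admissible eigenfunction (with parameters `L, Z, ω, lam` and
potential `φ`): it is `2L`-periodic, continuous, twice continuously differentiable off the
lattice `2Lℤ`, its one-sided derivatives at `0` exist with jump `w'(0+) - w'(0-) = -Z w(0)`,
and it solves `-w'' + ω w - 3 φ² w = lam · w` off the lattice. -/
def Admissible (L Z ω lam : ℝ) (φ w : ℝ → ℝ) : Prop :=
  Function.Periodic w (2 * L) ∧ Continuous w ∧
  ContDiffOn ℝ 2 w {x : ℝ | ∀ n : ℤ, x ≠ n * (2 * L)} ∧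
  (∃ a b : ℝ, Tendsto (deriv w) (nhdsWithin 0 (Set.Ioi 0)) (nhds a) ∧
    Tendsto (deriv w) (nhdsWithin 0 (Set.Iio 0)) (nhds b) ∧
    a - b = -Z * w 0) ∧
  ∀ x : ℝ, (∀ n : ℤ, x ≠ n * (2 * L)) →
    -(deriv (deriv w) x) + ω * w x - 3 * (φ x) ^ 2 * w x = lam * w x

/-- Admissibility is invariant under reflection when the potential is even. -/
theorem Admissible.comp_neg {L Z ω lam : ℝ} {φ w : ℝ → ℝ} (hφ : ∀ x : ℝ, φ (-x) = φ x)
    (hw : Admissible L Z ω lam φ w) : Admissible L Z ω lam φ (fun x => w (-x)) := by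
  obtain ⟨hper, hcont, hdiff, ⟨a, b, ha, hb, hab⟩, hode⟩ := hw
  have hoff : ∀ x : ℝ, (∀ n : ℤ, x ≠ n * (2 * L)) → ∀ n : ℤ, -x ≠ n * (2 * L) := by
    intro x hx n hn
    refine hx (-n) ?_
    push_cast
    linarith
  have hderiv : deriv (fun x => w (-x)) = fun x => -deriv w (-x) :=
    funext fun x => deriv_comp_neg w x
  have hright : Tendsto (fun x : ℝ => -x) (nhdsWithin 0 (Ioi 0)) (nhdsWithin 0 (Iio 0)) := by
    simpa using tendsto_neg_nhdsGT_neg (a := (0 : ℝ))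
  have hleft : Tendsto (fun x : ℝ => -x) (nhdsWithin 0 (Iio 0)) (nhdsWithin 0 (Ioi 0)) := by
    simpa using tendsto_neg_nhdsLT_neg (a := (0 : ℝ))
  refine ⟨fun x => ?_, hcont.comp continuous_neg, hdiff.comp contDiff_neg.contDiffOn hoff,
    ⟨-b, -a, ?_, ?_, ?_⟩, fun x hx => ?_⟩
  · simp only [neg_add']
    exact hper.sub_eq (-x)
  · rw [hderiv]
    exact (hb.comp hright).neg
  · rw [hderiv]
    exact (ha.comp hleft).neg
  · simp only [neg_zero]
    linarith
  · have h2 : deriv (fun y => -deriv w (-y)) x = deriv (deriv w) (-x) := by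
      rw [deriv.fun_neg, deriv_comp_neg, neg_neg]
    have h := hode (-x) (hoff x hx)
    rw [hφ] at h
    rw [hderiv, h2]
    exact h

/-- An eigenfunction associated to a simple eigenvalue of the linearized operator
`L₁,Z = -d²/dx² + ω - 3φ²` with periodic δ-interaction (with even potential `φ`)
is either even or odd. -/
theorem simple_eigenfunction_even_or_odd (L Z ω lam : ℝ) (hL : 0 < L) (hZ : Z ≠ 0)
    (φ : ℝ → ℝ) (hφc : Continuous φ) (hφe : ∀ x : ℝ, φ (-x) = φ x)
    (v : ℝ → ℝ) (hv : Admissible L Z ω lam φ v) (hv0 : v ≠ 0)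
    (hsimple : ∀ w : ℝ → ℝ, Admissible L Z ω lam φ w →
      ∃ β : ℝ, w = fun x => β * v x) :
    (∀ x : ℝ, v (-x) = v x) ∨ (∀ x : ℝ, v (-x) = -v x) := by
  obtain ⟨β, hβ⟩ := hsimple _ (hv.comp_neg hφe)
  have hneg : ∀ x, v (-x) = β * v x := congrFun hβ
  obtain ⟨x, hx⟩ := Function.ne_iff.mp hv0
  have hsq : β * β = 1 := by
    refine mul_right_cancel₀ hx ?_
    rw [mul_assoc, ← hneg, ← hneg, neg_neg, one_mul]
  rcases mul_self_eq_one_iff.mp hsq with rfl | rfl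
  · exact Or.inl fun y => by rw [hneg, one_mul]
  · exact Or.inr fun y => by rw [hneg, neg_one_mul]
end
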